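/- Let a deterministic linear loop program over ℝ^n be given by G ∈ ℝ^{m×n}, g ∈ ℝ^m, M ∈ ℝ^{n×n}, c ∈ ℝ^n, with transition relation T = {(x, x') : Gx ≤ g and x' = Mx + c}, and suppose every complex eigenvalue of M is a nonnegative real number. Then the loop is nonterminating if and only if there exists a geometric nontermination argument for the loop (of some size k ≤ n). -/

import Mathlib

open Matrix Polynomial Filter

/-! ### Iterated first-order differences of real sequences -/

lemma eventually_pow_le_of_le_sub {f : ℕ → ℝ} {a c : ℝ} (ha : 0 < a) (hc : 0 < c)
    (h : ∀ᶠ t in atTop, c * a ^ t ≤ f (t + 1) - a * f t) : ∀ᶠ t in atTop, a ^ t ≤ f t := by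
  obtain ⟨T, hT⟩ := eventually_atTop.1 h
  have key : ∀ s : ℕ, a ^ (T + s) * (f T / a ^ T + s * (c / a)) ≤ f (T + s) := by
    intro s
    induction s with
    | zero => simp only [add_zero, Nat.cast_zero, zero_mul]; field_simp; rfl
    | succ s ih =>
      have h1 := hT (T + s) (by omega)
      have h2 := mul_le_mul_of_nonneg_left ih ha.le
      have h3 : a ^ (T + (s + 1)) * (f T / a ^ T + ((s + 1 : ℕ) : ℝ) * (c / a)) =
          a * (a ^ (T + s) * (f T / a ^ T + s * (c / a))) + c * a ^ (T + s) := by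
        push_cast
        field_simp
        ring
      rw [h3, ← add_assoc T s 1]
      linarith
  obtain ⟨N, hN⟩ := exists_nat_ge ((1 - f T / a ^ T) / (c / a))
  refine eventually_atTop.2 ⟨T + N, fun t ht => ?_⟩
  obtain ⟨s, rfl⟩ : ∃ s, t = T + s := ⟨t - T, by omega⟩
  have hs : (N : ℝ) ≤ s := by exact_mod_cast (by omega : N ≤ s)
  have h1 : 1 - f T / a ^ T ≤ s * (c / a) :=
    (div_le_iff₀ (by positivity)).1 (hN.trans hs)
  refine le_trans ?_ (key s)
  exact le_mul_of_one_le_right (by positivity) (by linarith)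

/-- The sequences `f j` are all eventually nonnegative, and `f 0` grows at least like `b ^ t`. -/
def EventuallyDominates (b : ℝ) (f : ℕ → ℕ → ℝ) : Prop :=
  (∃ c > 0, ∀ᶠ t in atTop, c * b ^ t ≤ f 0 t) ∧ ∀ j, ∀ᶠ t in atTop, 0 ≤ f j t

lemma EventuallyDominates.of_succ {a b : ℝ} {f : ℕ → ℕ → ℝ} (hb : 0 < b) (hba : b ≤ a)
    (hf : ∀ t, f 1 t = f 0 (t + 1) - a * f 0 t)
    (h : EventuallyDominates a fun j => f (j + 1)) : EventuallyDominates b f := by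
  obtain ⟨⟨c, hc, hct⟩, hj⟩ := h
  have h0 : ∀ᶠ t in atTop, a ^ t ≤ f 0 t :=
    eventually_pow_le_of_le_sub (hb.trans_le hba) hc <| hct.mono fun t ht => by
      rw [← hf]; exact ht
  refine ⟨⟨1, one_pos, h0.mono fun t ht => ?_⟩, fun j => ?_⟩
  · rw [one_mul]
    exact (pow_le_pow_left₀ hb.le hba t).trans ht
  · cases j with
    | zero => exact h0.mono fun t ht => (pow_nonneg (hb.le.trans hba) t).trans ht
    | succ j => exact hj j

lemma EventuallyDominates.of_geometric {a b : ℝ} {f : ℕ → ℕ → ℝ} (hb : 0 < b) (hba : b ≤ a)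
    (hf : ∀ t, f 0 (t + 1) = a * f 0 t) (hsucc : ∀ j t, f (j + 1) t = 0) (h0 : 0 < f 0 0) :
    EventuallyDominates b f := by
  have hpow : ∀ t, f 0 t = f 0 0 * a ^ t := by
    intro t
    induction t with
    | zero => simp
    | succ t ih => rw [hf, ih]; ring
  refine ⟨⟨f 0 0, h0, Eventually.of_forall fun t => ?_⟩, fun j => Eventually.of_forall fun t => ?_⟩
  · rw [hpow t]
    exact mul_le_mul_of_nonneg_left (pow_le_pow_left₀ hb.le hba t) h0.le
  · cases j with
    | zero => rw [hpow t]; exact mul_nonneg h0.le (pow_nonneg (hb.le.trans hba) t)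
    | succ j => exact (hsucc j t).ge

/-- A linear recurrent sequence with positive characteristic roots has an eventual sign, which is
inherited by its iterated differences when the roots are removed in increasing order. -/
lemma eq_zero_or_eventuallyDominates (k : ℕ) : ∀ (a : ℕ → ℝ) (f : ℕ → ℕ → ℝ) (b : ℝ), 0 < b →
    (∀ j < k, b ≤ a j) → (∀ i j, i ≤ j → j < k → a i ≤ a j) →
    (∀ j < k, ∀ t, f (j + 1) t = f j (t + 1) - a j * f j t) → (∀ j, k ≤ j → ∀ t, f j t = 0) →
    (∀ j t, f j t = 0) ∨ EventuallyDominates b f ∨ EventuallyDominates b fun j t => -f j t := by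
  induction k with
  | zero => exact fun a f b _ _ _ _ h => Or.inl fun j => h j (Nat.zero_le j)
  | succ k ih =>
    intro a f b hb hba hmono hf hzero
    have ha0 : b ≤ a 0 := hba 0 k.succ_pos
    have hf0 := hf 0 k.succ_pos
    rcases ih (fun j => a (j + 1)) (fun j => f (j + 1)) (a 0) (hb.trans_le ha0)
      (fun j hj => hmono 0 (j + 1) (Nat.zero_le _) (by omega))
      (fun i j hij hj => hmono (i + 1) (j + 1) (by omega) (by omega))
      (fun j hj => hf (j + 1) (by omega)) (fun j hj => hzero (j + 1) (by omega)) with h | h | h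
    · have hgeo : ∀ t, f 0 (t + 1) = a 0 * f 0 t := fun t => by
        have h1 := hf0 t
        rw [h 0 t] at h1
        linarith
      rcases lt_trichotomy (f 0 0) 0 with h0 | h0 | h0
      · exact Or.inr <| Or.inr <| .of_geometric hb ha0 (fun t => by simp only [hgeo t]; ring)
          (fun j t => by simp only [h j t, neg_zero]) (by simpa using h0)
      · refine Or.inl fun j t => ?_
        cases j with
        | zero =>
          induction t with
          | zero => exact h0
          | succ t iht => rw [hgeo, iht, mul_zero]
        | succ j => exact h j t
      · exact Or.inr <| Or.inl <| .of_geometric hb ha0 hgeo h h0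
    · exact Or.inr <| Or.inl <| .of_succ hb ha0 hf0 h
    · exact Or.inr <| Or.inr <| .of_succ hb ha0 (fun t => by
        have h1 := hf0 t
        simp only [zero_add] at h1
        rw [h1]; ring) h

/-- If `g = f (· + 1) - a f` decays geometrically and `0 ≤ a < 1`, then `f` decays
geometrically. -/
lemma exists_geometric_bound {f : ℕ → ℝ} {a C ρ : ℝ} (ha0 : 0 ≤ a) (ha1 : a < 1) (hC : 0 ≤ C)
    (hρ0 : 0 < ρ) (hρ1 : ρ < 1) (h : ∀ t, |f (t + 1) - a * f t| ≤ C * ρ ^ t) :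
    ∃ C' ρ' : ℝ, 0 ≤ C' ∧ 0 < ρ' ∧ ρ' < 1 ∧ ∀ t, |f t| ≤ C' * ρ' ^ t := by
  set σ := max ρ ((1 + a) / 2)
  have hσρ : ρ ≤ σ := le_max_left _ _
  have hσa : a < σ := lt_of_lt_of_le (by linarith) (le_max_right _ _)
  have hσ0 : 0 < σ := hρ0.trans_le hσρ
  set D := max |f 0| (C / (σ - a))
  have hD0 : |f 0| ≤ D := le_max_left _ _
  have hD : C ≤ D * (σ - a) := (div_le_iff₀ (by linarith)).1 (le_max_right _ _)
  refine ⟨D, σ, (abs_nonneg _).trans hD0, hσ0, max_lt hρ1 (by linarith), fun t => ?_⟩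
  induction t with
  | zero => simpa using hD0
  | succ t ih =>
    have h1 : |f (t + 1)| ≤ |f (t + 1) - a * f t| + a * |f t| := by
      have := abs_add_le (f (t + 1) - a * f t) (a * f t)
      rwa [sub_add_cancel, abs_mul, abs_of_nonneg ha0] at this
    have h2 : C * ρ ^ t ≤ C * σ ^ t :=
      mul_le_mul_of_nonneg_left (pow_le_pow_left₀ hρ0.le hσρ t) hC
    have h3 : a * |f t| ≤ a * (D * σ ^ t) := mul_le_mul_of_nonneg_left ih ha0
    have h4 : C * σ ^ t ≤ D * (σ - a) * σ ^ t := mul_le_mul_of_nonneg_right hD (by positivity)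
    have h5 := h t
    rw [pow_succ]
    nlinarith

/-! ### Polynomials with prescribed roots -/

lemma isCoprime_X_sub_C_of_eval_ne_zero {p : ℝ[X]} {a : ℝ} (h : p.eval a ≠ 0) :
    IsCoprime p (X - C a) :=
  ((irreducible_X_sub_C a).coprime_iff_not_dvd.2 fun hd => h (dvd_iff_isRoot.1 hd)).symm

/-- The product `∏ l < j, (X - a l)`. -/
noncomputable def prodXSubC (a : ℕ → ℝ) (j : ℕ) : ℝ[X] :=
  ∏ l ∈ Finset.range j, (X - C (a l))

lemma prodXSubC_succ (a : ℕ → ℝ) (j : ℕ) :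
    prodXSubC a (j + 1) = prodXSubC a j * (X - C (a j)) :=
  Finset.prod_range_succ _ _

lemma prodXSubC_dvd (a : ℕ → ℝ) {i j : ℕ} (h : i ≤ j) : prodXSubC a i ∣ prodXSubC a j :=
  Finset.prod_dvd_prod_of_subset _ _ _ (Finset.range_mono h)

lemma isCoprime_sum_prodXSubC {a : ℕ → ℝ} {k : ℕ} (hmono : ∀ i j, i ≤ j → j < k → a i ≤ a j) :
    IsCoprime (∑ j ∈ Finset.range k, prodXSubC a j) (prodXSubC a k) := by
  refine IsCoprime.prod_right fun l hl => isCoprime_X_sub_C_of_eval_ne_zero ?_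
  have hl := Finset.mem_range.1 hl
  have hnonneg : ∀ j ∈ Finset.range k, 0 ≤ (prodXSubC a j).eval (a l) := by
    intro j hj
    simp only [prodXSubC, eval_prod, eval_sub, eval_X, eval_C]
    by_cases hjl : j ≤ l
    · refine Finset.prod_nonneg fun i hi => sub_nonneg.2 (hmono i l ?_ hl)
      have := Finset.mem_range.1 hi
      omega
    · exact (Finset.prod_eq_zero (Finset.mem_range.2 (not_le.1 hjl)) (sub_self _)).ge
  have h1 := Finset.single_le_sum hnonneg (Finset.mem_range.2 (l.zero_le.trans_lt hl))
  rw [eval_finsetSum]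
  have h2 : (prodXSubC a 0).eval (a l) = 1 := by simp [prodXSubC]
  linarith

/-- A real polynomial splits when all its complex roots are real. -/
lemma splits_of_forall_im_eq_zero {p : ℝ[X]}
    (h : ∀ z : ℂ, (p.map Complex.ofRealHom).IsRoot z → z.im = 0) : p.Splits := by
  rcases eq_or_ne p 0 with rfl | hp
  · exact .zero
  refine Splits.of_splits_map Complex.ofRealHom (IsAlgClosed.splits _) fun z hz => ?_
  exact ⟨z.re, Complex.ext rfl (h z (isRoot_of_mem_roots hz)).symm⟩

/-! ### Orbits of a matrix under a linear functional -/

section Orbit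

variable {ι : Type*} [Fintype ι] [DecidableEq ι]

lemma aeval_mul_mulVec (M : Matrix ι ι ℝ) (p q : ℝ[X]) (v : ι → ℝ) :
    aeval M (p * q) *ᵥ v = aeval M p *ᵥ (aeval M q *ᵥ v) := by
  rw [map_mul, mulVec_mulVec]

lemma pow_mulVec_aeval_comm (M : Matrix ι ι ℝ) (p : ℝ[X]) (t : ℕ) (v : ι → ℝ) :
    M ^ t *ᵥ (aeval M p *ᵥ v) = aeval M p *ᵥ (M ^ t *ᵥ v) := by
  have h := aeval_mul_mulVec M (X ^ t) p v
  rw [mul_comm, aeval_mul_mulVec, map_pow, aeval_X] at h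
  exact h.symm

lemma aeval_X_sub_C_mulVec (M : Matrix ι ι ℝ) (a : ℝ) (v : ι → ℝ) :
    aeval M (X - C a) *ᵥ v = M *ᵥ v - a • v := by
  rw [map_sub, aeval_X, aeval_C, sub_mulVec, Algebra.algebraMap_eq_smul_one, smul_mulVec,
    one_mulVec]

lemma aeval_mulVec_eq_zero_of_dvd {M : Matrix ι ι ℝ} {p q : ℝ[X]} {v : ι → ℝ} (h : p ∣ q)
    (hp : aeval M p *ᵥ v = 0) : aeval M q *ᵥ v = 0 := by
  obtain ⟨s, rfl⟩ := h
  rw [mul_comm, aeval_mul_mulVec, hp, mulVec_zero]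

lemma dotProduct_pow_mulVec_sub (M : Matrix ι ι ℝ) (r v : ι → ℝ) (a : ℝ) (t : ℕ) :
    r ⬝ᵥ (M ^ t *ᵥ (aeval M (X - C a) *ᵥ v)) =
      r ⬝ᵥ (M ^ (t + 1) *ᵥ v) - a * (r ⬝ᵥ (M ^ t *ᵥ v)) := by
  rw [aeval_X_sub_C_mulVec, mulVec_sub, dotProduct_sub, mulVec_smul, dotProduct_smul,
    mulVec_mulVec, ← pow_succ, smul_eq_mul]

lemma exists_geometric_bound_of_aeval (M : Matrix ι ι ℝ) (r : ι → ℝ) (s : Multiset ℝ) :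
    ∀ v : ι → ℝ, (∀ a ∈ s, 0 ≤ a ∧ a < 1) → aeval M (s.map fun a => X - C a).prod *ᵥ v = 0 →
      ∃ B ρ : ℝ, 0 ≤ B ∧ 0 < ρ ∧ ρ < 1 ∧ ∀ t, |r ⬝ᵥ (M ^ t *ᵥ v)| ≤ B * ρ ^ t := by
  induction s using Multiset.induction with
  | empty =>
    intro v _ hv
    have hv : v = 0 := by simpa using hv
    exact ⟨0, 1 / 2, le_rfl, by norm_num, by norm_num, fun t => by simp [hv]⟩
  | cons a s ih =>
    intro v hs hv
    rw [Multiset.map_cons, Multiset.prod_cons, mul_comm, aeval_mul_mulVec] at hv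
    obtain ⟨B, ρ, hB, hρ0, hρ1, h⟩ := ih _ (fun b hb => hs b (Multiset.mem_cons_of_mem hb)) hv
    obtain ⟨ha0, ha1⟩ := hs a (Multiset.mem_cons_self a s)
    exact exists_geometric_bound (f := fun t => r ⬝ᵥ (M ^ t *ᵥ v)) ha0 ha1 hB hρ0 hρ1 fun t => by
      rw [← dotProduct_pow_mulVec_sub]
      exact h t

lemma tendsto_dotProduct_pow_mulVec {M : Matrix ι ι ℝ} (r : ι → ℝ) {s : Multiset ℝ} {v : ι → ℝ}
    (hs : ∀ a ∈ s, 0 ≤ a ∧ a < 1) (hv : aeval M (s.map fun a => X - C a).prod *ᵥ v = 0) :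
    Tendsto (fun t => r ⬝ᵥ (M ^ t *ᵥ v)) atTop (nhds 0) := by
  obtain ⟨B, ρ, -, hρ0, hρ1, h⟩ := exists_geometric_bound_of_aeval M r s v hs hv
  refine squeeze_zero_norm h ?_
  simpa using (tendsto_pow_atTop_nhds_zero_of_lt_one hρ0.le hρ1).const_mul B

lemma dotProduct_orbit_trichotomy {M : Matrix ι ι ℝ} (r : ι → ℝ) {a : ℕ → ℝ} {k : ℕ} {w : ι → ℝ}
    (ha : ∀ j < k, 1 ≤ a j) (hmono : ∀ i j, i ≤ j → j < k → a i ≤ a j)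
    (hw : aeval M (prodXSubC a k) *ᵥ w = 0) :
    (∀ j t, r ⬝ᵥ (M ^ t *ᵥ (aeval M (prodXSubC a j) *ᵥ w)) = 0) ∨
      EventuallyDominates 1 (fun j t => r ⬝ᵥ (M ^ t *ᵥ (aeval M (prodXSubC a j) *ᵥ w))) ∨
      EventuallyDominates 1 fun j t => -(r ⬝ᵥ (M ^ t *ᵥ (aeval M (prodXSubC a j) *ᵥ w))) := by
  refine eq_zero_or_eventuallyDominates k a _ 1 one_pos ha hmono (fun j _ t => ?_)
    fun j hj t => ?_
  · rw [prodXSubC_succ, mul_comm, aeval_mul_mulVec, dotProduct_pow_mulVec_sub]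
  · rw [aeval_mulVec_eq_zero_of_dvd (prodXSubC_dvd a hj) hw, mulVec_zero, dotProduct_zero]

lemma dotProduct_orbit_sign {M : Matrix ι ι ℝ} (r : ι → ℝ) {a : ℕ → ℝ} {k : ℕ} {u : ι → ℝ}
    (ha : ∀ j < k, 1 ≤ a j) (hmono : ∀ i j, i ≤ j → j < k → a i ≤ a j)
    (hu : aeval M (prodXSubC a k) *ᵥ u = 0) :
    (∀ t, r ⬝ᵥ (M ^ t *ᵥ u) = 0) ∨
      (∃ c > 0, ∀ᶠ t in atTop, c ≤ r ⬝ᵥ (M ^ t *ᵥ u)) ∨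
      ∃ c > 0, ∀ᶠ t in atTop, c ≤ -(r ⬝ᵥ (M ^ t *ᵥ u)) := by
  have h0 : aeval M (prodXSubC a 0) *ᵥ u = u := by simp [prodXSubC]
  rcases dotProduct_orbit_trichotomy r ha hmono hu with h | ⟨h, -⟩ | ⟨h, -⟩
  · exact Or.inl fun t => by simpa only [h0] using h 0 t
  · exact Or.inr <| Or.inl <| by simpa only [h0, one_pow, mul_one] using h
  · exact Or.inr <| Or.inr <| by simpa only [h0, one_pow, mul_one] using h

/-- A vector `u` killed by `∏ l < k, (M - a l)` is the sum of a chain `∏ l < j, (M - a l) w`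
whose members inherit every eventual upper bound `r ⬝ᵥ M ^ t u ≤ 0`. -/
lemma exists_chain {M : Matrix ι ι ℝ} {a : ℕ → ℝ} {k : ℕ} {u : ι → ℝ}
    (ha : ∀ j < k, 1 ≤ a j) (hmono : ∀ i j, i ≤ j → j < k → a i ≤ a j)
    (hu : aeval M (prodXSubC a k) *ᵥ u = 0) :
    ∃ w : ι → ℝ, aeval M (prodXSubC a k) *ᵥ w = 0 ∧
      ∑ j ∈ Finset.range k, aeval M (prodXSubC a j) *ᵥ w = u ∧
      ∀ r : ι → ℝ, (∀ᶠ t in atTop, r ⬝ᵥ (M ^ t *ᵥ u) ≤ 0) →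
        ∀ j, ∀ᶠ t in atTop, r ⬝ᵥ (M ^ t *ᵥ (aeval M (prodXSubC a j) *ᵥ w)) ≤ 0 := by
  obtain ⟨p, q, hpq⟩ := isCoprime_sum_prodXSubC hmono
  have hw : aeval M (prodXSubC a k) *ᵥ (aeval M p *ᵥ u) = 0 := by
    rw [← aeval_mul_mulVec, mul_comm, aeval_mul_mulVec, hu, mulVec_zero]
  have hsum : ∑ j ∈ Finset.range k, aeval M (prodXSubC a j) *ᵥ (aeval M p *ᵥ u) = u := by
    rw [← sum_mulVec, ← map_sum, ← aeval_mul_mulVec, mul_comm, eq_sub_of_add_eq hpq, map_sub,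
      sub_mulVec, aeval_mul_mulVec, hu, mulVec_zero, sub_zero, map_one, one_mulVec]
  refine ⟨aeval M p *ᵥ u, hw, hsum, fun r hr j => ?_⟩
  rcases dotProduct_orbit_trichotomy r ha hmono hw with h | ⟨⟨c, hc, h0⟩, h⟩ | ⟨-, h⟩
  · exact Eventually.of_forall fun t => (h j t).le
  · exfalso
    have hall := (eventually_all_finset (Finset.range k)).2 fun j _ => h j
    obtain ⟨t, ht0, htr, hta⟩ := (h0.and (hr.and hall)).exists
    rw [one_pow, mul_one] at ht0
    rcases Nat.eq_zero_or_pos k with rfl | hk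
    · have hz : aeval M p *ᵥ u = 0 := by simpa [prodXSubC] using hw
      simp only [hz, mulVec_zero, dotProduct_zero] at ht0
      linarith
    · have h1 := Finset.single_le_sum hta (Finset.mem_range.2 hk)
      rw [← dotProduct_sum, ← mulVec_sum, hsum] at h1
      linarith
  · exact (h j).mono fun t ht => neg_nonneg.1 ht

end Orbit

/-- A sequence with increments of eventual constant sign that is asymptotically bounded above by
`g` eventually satisfies the bound and is eventually nonincreasing. -/
lemma eventually_le_of_tendsto {z d e : ℕ → ℝ} {g : ℝ} (hd : ∀ t, z (t + 1) = z t + d t)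
    (he : Tendsto e atTop (nhds 0)) (hz : ∀ t, z t + e t ≤ g)
    (hsign : (∀ t, d t = 0) ∨ (∃ c > 0, ∀ᶠ t in atTop, c ≤ d t) ∨
      ∃ c > 0, ∀ᶠ t in atTop, c ≤ -d t) :
    ∀ᶠ t in atTop, z t ≤ g ∧ d t ≤ 0 := by
  rcases hsign with h | ⟨c, hc, h⟩ | ⟨c, hc, h⟩
  · have hconst : ∀ t, z t = z 0 := fun t => by
      induction t with
      | zero => rfl
      | succ t ih => rw [hd, h, add_zero, ih]
    have hlim : Tendsto (fun t => z 0 + e t) atTop (nhds (z 0)) := by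
      simpa using he.const_add (z 0)
    have h0 : z 0 ≤ g := le_of_tendsto' hlim fun t => by rw [← hconst t]; exact hz t
    exact Eventually.of_forall fun t => ⟨(hconst t).trans_le h0, (h t).le⟩
  · exfalso
    have h1 := eventually_pow_le_of_le_sub (f := fun t => z t - g) one_pos hc <|
      h.mono fun t ht => by
        simp only [hd, one_pow]
        linarith
    obtain ⟨t, ht, hte⟩ := (h1.and (he.eventually (lt_mem_nhds neg_one_lt_zero))).exists
    have := hz t
    simp only [one_pow] at ht
    linarith
  · have h1 := eventually_pow_le_of_le_sub (f := fun t => g - z t) one_pos hc <|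
      h.mono fun t ht => by
        simp only [hd, one_pow]
        linarith
    filter_upwards [h, h1] with t ht ht1
    simp only [one_pow] at ht1
    constructor <;> linarith

/-! ### Nontermination of affine loops -/

open scoped NNReal in
lemma exists_orbit_of_mem_span {ι : Type*} {n m : ℕ} {G : Matrix (Fin m) (Fin n) ℝ}
    {g : Fin m → ℝ} {M : Matrix (Fin n) (Fin n) ℝ} {c x₁ : Fin n → ℝ} {y : ι → Fin n → ℝ}
    (hG : ∀ i, G *ᵥ y i ≤ 0) (hM : ∀ i, M *ᵥ y i ∈ Submodule.span ℝ≥0 (Set.range y))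
    (hx : G *ᵥ x₁ ≤ g) (hd : M *ᵥ x₁ + c - x₁ ∈ Submodule.span ℝ≥0 (Set.range y)) :
    ∃ x : ℕ → Fin n → ℝ, ∀ t : ℕ, G *ᵥ x t ≤ g ∧ x (t + 1) = M *ᵥ x t + c := by
  have hGK : ∀ v ∈ Submodule.span ℝ≥0 (Set.range y), G *ᵥ v ≤ 0 := by
    intro v hv
    induction hv using Submodule.span_induction with
    | mem v hv => obtain ⟨i, rfl⟩ := hv; exact hG i
    | zero => rw [mulVec_zero]
    | add v w _ _ hv hw => rw [mulVec_add]; exact add_nonpos hv hw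
    | smul r v _ hv =>
      rw [NNReal.smul_def, mulVec_smul]
      exact smul_nonpos_of_nonneg_of_nonpos r.2 hv
  have hMK : ∀ v ∈ Submodule.span ℝ≥0 (Set.range y),
      M *ᵥ v ∈ Submodule.span ℝ≥0 (Set.range y) := by
    intro v hv
    induction hv using Submodule.span_induction with
    | mem v hv => obtain ⟨i, rfl⟩ := hv; exact hM i
    | zero => rw [mulVec_zero]; exact Submodule.zero_mem _
    | add v w _ _ hv hw => rw [mulVec_add]; exact Submodule.add_mem _ hv hw
    | smul r v _ hv =>
      rw [NNReal.smul_def, mulVec_smul, ← NNReal.smul_def]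
      exact Submodule.smul_mem _ r hv
  let x : ℕ → Fin n → ℝ := fun t => (fun v => M *ᵥ v + c)^[t] x₁
  have hstep : ∀ t, x (t + 1) = M *ᵥ x t + c := fun t =>
    Function.iterate_succ_apply' (fun v => M *ᵥ v + c) t x₁
  have hinv : ∀ t, G *ᵥ x t ≤ g ∧ x (t + 1) - x t ∈ Submodule.span ℝ≥0 (Set.range y) := by
    intro t
    induction t with
    | zero => exact ⟨hx, by rw [hstep]; exact hd⟩
    | succ t ih =>
      refine ⟨?_, ?_⟩
      · have h := add_le_add ih.1 (hGK _ ih.2)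
        rwa [← mulVec_add, add_sub_cancel, add_zero] at h
      · rw [hstep (t + 1)]
        nth_rw 2 [hstep t]
        rw [add_sub_add_right_eq_sub, ← mulVec_sub]
        exact hMK _ ih.2
  exact ⟨x, fun t => ⟨(hinv t).1, hstep t⟩⟩

/-- Removing the part of the orbit that belongs to eigenvalues in `[0, 1)` turns a nonterminating
orbit into one whose increments are `M ^ t u` with `u` killed by `∏ l < k, (M - a l)`. -/
lemma exists_orbit_without_decay {n m : ℕ} {G : Matrix (Fin m) (Fin n) ℝ} {g : Fin m → ℝ}
    {M : Matrix (Fin n) (Fin n) ℝ} {c : Fin n → ℝ} {a : ℕ → ℝ} {k : ℕ} {s : Multiset ℝ}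
    (ha : ∀ j < k, 1 ≤ a j) (hmono : ∀ i j, i ≤ j → j < k → a i ≤ a j)
    (hs : ∀ b ∈ s, 0 ≤ b ∧ b < 1)
    (hM : aeval M (prodXSubC a k * (s.map fun b => X - C b).prod) = 0)
    {x : ℕ → Fin n → ℝ} (hx : ∀ t : ℕ, G *ᵥ x t ≤ g ∧ x (t + 1) = M *ᵥ x t + c) :
    ∃ (z : ℕ → Fin n → ℝ) (u : Fin n → ℝ), aeval M (prodXSubC a k) *ᵥ u = 0 ∧
      (∀ t, z t + M ^ t *ᵥ u = M *ᵥ z t + c) ∧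
      ∀ i, ∀ᶠ t in atTop, G i ⬝ᵥ z t ≤ g i ∧ G i ⬝ᵥ (M ^ t *ᵥ u) ≤ 0 := by
  set A := prodXSubC a k
  set B := (s.map fun b => X - C b).prod
  have hcop : IsCoprime ((X - C 1) * A) B := by
    refine .symm <| .mul_right (isCoprime_X_sub_C_of_eval_ne_zero ?_) <|
      .prod_right fun l hl => isCoprime_X_sub_C_of_eval_ne_zero ?_
    all_goals
      simp only [B, eval_multiset_prod, Multiset.map_map, Function.comp_def, eval_sub, eval_X,
        eval_C, ne_eq, Multiset.prod_eq_zero_iff, Multiset.mem_map, not_exists, not_and]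
      intro b hb h0
      have h1 := (hs b hb).2
    · linarith
    · have := ha l (Finset.mem_range.1 hl)
      linarith
  obtain ⟨p, q, hpq⟩ := hcop
  have hAB : ∀ v : Fin n → ℝ, aeval M (A * B) *ᵥ v = 0 := fun v => by rw [hM, zero_mulVec]
  set d := x 1 - x 0
  set v := aeval M (p * A) *ᵥ d
  set u := aeval M (q * B) *ᵥ d
  have hv : aeval M B *ᵥ v = 0 := by
    rw [← aeval_mul_mulVec, show B * (p * A) = p * (A * B) by ring, aeval_mul_mulVec, hAB,
      mulVec_zero]
  have hu : aeval M A *ᵥ u = 0 := by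
    rw [← aeval_mul_mulVec, show A * (q * B) = q * (A * B) by ring, aeval_mul_mulVec, hAB,
      mulVec_zero]
  have hd : M *ᵥ v - v + u = d := by
    have h := aeval_X_sub_C_mulVec M 1 v
    rw [one_smul] at h
    rw [← h, ← aeval_mul_mulVec, ← add_mulVec, ← map_add,
      show (X - C 1) * (p * A) + q * B = 1 by rw [← hpq]; ring, map_one, one_mulVec]
  clear_value v u
  have hdt : ∀ t, x (t + 1) = x t + M ^ t *ᵥ d := by
    intro t
    induction t with
    | zero => simp [d]
    | succ t ih =>
      rw [(hx (t + 1)).2]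
      nth_rw 1 [ih]
      rw [mulVec_add, mulVec_mulVec, ← pow_succ', (hx t).2]
      abel
  set z : ℕ → Fin n → ℝ := fun t => x t - M ^ t *ᵥ v
  have hz : ∀ t, z t + M ^ t *ᵥ u = M *ᵥ z t + c := by
    intro t
    have h1 := (hx t).2
    rw [hdt, ← hd, mulVec_add, mulVec_sub, mulVec_mulVec, ← pow_succ, pow_succ'] at h1
    simp only [z]
    rw [mulVec_sub, mulVec_mulVec, sub_add_eq_add_sub (M *ᵥ x t), ← h1]
    abel
  have hzsucc : ∀ t, z (t + 1) = z t + M ^ t *ᵥ u := by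
    intro t
    rw [hz]
    simp only [z]
    rw [(hx t).2, mulVec_sub, mulVec_mulVec, ← pow_succ']
    abel
  refine ⟨z, u, hu, hz, fun i => ?_⟩
  refine eventually_le_of_tendsto (e := fun t => G i ⬝ᵥ (M ^ t *ᵥ v)) (fun t => ?_)
    (tendsto_dotProduct_pow_mulVec (G i) hs hv) (fun t => ?_)
    (dotProduct_orbit_sign (G i) ha hmono hu)
  · rw [hzsucc, dotProduct_add]
  · rw [← dotProduct_add, sub_add_cancel]
    exact (hx t).1 i

/-- If all complex roots of a monic real polynomial are nonnegative reals, it is the product of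
the sorted linear factors with root at least `1` and the linear factors with root in `[0, 1)`. -/
lemma exists_sorted_factorization {p : ℝ[X]} (hp : p.Monic)
    (h : ∀ z : ℂ, (p.map Complex.ofRealHom).IsRoot z → z.im = 0 ∧ 0 ≤ z.re) :
    ∃ (k : ℕ) (a : ℕ → ℝ) (s : Multiset ℝ), k ≤ p.natDegree ∧ (∀ j < k, 1 ≤ a j) ∧
      (∀ i j, i ≤ j → j < k → a i ≤ a j) ∧ (∀ b ∈ s, 0 ≤ b ∧ b < 1) ∧
      p = prodXSubC a k * (s.map fun b => X - C b).prod := by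
  have hsplit := splits_of_forall_im_eq_zero fun z hz => (h z hz).1
  have hnonneg : ∀ b ∈ p.roots, 0 ≤ b := fun b hb =>
    (h b ((isRoot_of_mem_roots hb).map (f := Complex.ofRealHom))).2
  set L := (p.roots.filter fun b => 1 ≤ b).sort
  have hL : (L : Multiset ℝ) = p.roots.filter fun b => 1 ≤ b := Multiset.sort_eq _ _
  have hget : ∀ j (hj : j < L.length), L.getD j 0 = L[j] := fun j hj => by
    simp [hj]
  refine ⟨L.length, fun j => L.getD j 0, p.roots.filter fun b => ¬ 1 ≤ b, ?_, fun j hj => ?_,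
    fun i j hij hj => ?_, fun b hb => ?_, ?_⟩
  · rw [← Multiset.coe_card, hL]
    exact (Multiset.card_le_card (Multiset.filter_le _ _)).trans (card_roots' p)
  · simp only [hget j hj]
    have hmem : L[j] ∈ (L : Multiset ℝ) := Multiset.mem_coe.2 (List.getElem_mem hj)
    rw [hL] at hmem
    exact (Multiset.mem_filter.1 hmem).2
  · simp only [hget j hj, hget i (hij.trans_lt hj)]
    have hsorted : L.Pairwise (· ≤ ·) := Multiset.pairwise_sort _ _
    rcases hij.eq_or_lt with rfl | hlt
    · exact le_rfl
    · exact List.pairwise_iff_getElem.1 hsorted i j (hij.trans_lt hj) hj hlt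
  · obtain ⟨hb, hb1⟩ := Multiset.mem_filter.1 hb
    exact ⟨hnonneg b hb, not_le.1 hb1⟩
  · have hprod : prodXSubC (fun j => L.getD j 0) L.length =
        ((L : Multiset ℝ).map fun b => X - C b).prod := by
      rw [prodXSubC, Finset.prod_range, Multiset.map_coe, Multiset.prod_coe,
        ← Fin.prod_univ_fun_getElem L fun b => X - C b]
      exact Finset.prod_congr rfl fun j _ => by rw [hget j j.2]
    rw [hprod, hL, ← Multiset.prod_add, ← Multiset.map_add, Multiset.filter_add_not]
    exact hsplit.eq_prod_roots_of_monic hp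



/-- For a deterministic linear loop program `while (Gx ≤ g) do x := Mx + c` whose
update matrix `M` has only nonnegative real eigenvalues, nontermination is
equivalent to the existence of a geometric nontermination argument of size `k ≤ n`. -/
theorem nonterminating_iff_gnta {n m : ℕ}
    (G : Matrix (Fin m) (Fin n) ℝ) (g : Fin m → ℝ)
    (M : Matrix (Fin n) (Fin n) ℝ) (c : Fin n → ℝ)
    -- every complex eigenvalue of `M` is a nonnegative real number
    (heig : ∀ z : ℂ, ((M.map (Complex.ofReal ·)).charpoly).IsRoot z → z.im = 0 ∧ 0 ≤ z.re) :
    -- nontermination ↔ existence of a GNTA of size at most `n`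
    (∃ x : ℕ → Fin n → ℝ, ∀ t : ℕ, G *ᵥ x t ≤ g ∧ x (t + 1) = M *ᵥ x t + c) ↔
    (∃ k : ℕ, k ≤ n ∧
      ∃ (x1 : Fin n → ℝ) (y : Fin k → Fin n → ℝ)
        (lam : Fin k → ℝ) (mu : Fin (k - 1) → ℝ),
        -- (domain)
        (∀ i, 0 ≤ lam i) ∧ (∀ i, 0 ≤ mu i) ∧
        -- (point): A (x₁ ; x₁ + Σᵢ yᵢ) ≤ b
        (G *ᵥ x1 ≤ g ∧ x1 + ∑ i, y i = M *ᵥ x1 + c) ∧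
        -- (ray): A (yᵢ ; λᵢ yᵢ + μ_{i-1} y_{i-1}) ≤ 0
        (∀ i : Fin k, G *ᵥ y i ≤ 0 ∧
          (lam i • y i +
            if h : 0 < (i : ℕ) then
              mu ⟨(i : ℕ) - 1, by have := i.isLt; omega⟩ •
                y ⟨(i : ℕ) - 1, by have := i.isLt; omega⟩
            else 0) = M *ᵥ y i)) := by
  constructor
  · rintro ⟨x, hx⟩
    obtain ⟨k, a, s, hk, ha, hmono, hs, hfac⟩ :=
      exists_sorted_factorization M.charpoly_monic fun z hz =>
        heig z (by rwa [← charpoly_map M Complex.ofRealHom] at hz)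
    have hM := aeval_self_charpoly M
    rw [hfac] at hM
    obtain ⟨z, u, hu, hz, hGz⟩ := exists_orbit_without_decay ha hmono hs hM hx
    obtain ⟨w, hw, hsum, hwG⟩ := exists_chain ha hmono hu
    have hev : ∀ᶠ t in atTop, ∀ i, G i ⬝ᵥ z t ≤ g i ∧
        ∀ j ∈ Finset.range k, G i ⬝ᵥ (M ^ t *ᵥ (aeval M (prodXSubC a j) *ᵥ w)) ≤ 0 :=
      eventually_all.2 fun i => ((hGz i).mono fun t ht => ht.1).and <|
        (eventually_all_finset _).2 fun j _ => hwG (G i) ((hGz i).mono fun t ht => ht.2) j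
    obtain ⟨T, hT⟩ := hev.exists
    have hMstep : ∀ j, M *ᵥ (M ^ T *ᵥ (aeval M (prodXSubC a j) *ᵥ w)) =
        a j • (M ^ T *ᵥ (aeval M (prodXSubC a j) *ᵥ w)) +
          M ^ T *ᵥ (aeval M (prodXSubC a (j + 1)) *ᵥ w) := by
      intro j
      rw [prodXSubC_succ, mul_comm (prodXSubC a j), aeval_mul_mulVec,
        pow_mulVec_aeval_comm M (X - C (a j)), aeval_X_sub_C_mulVec, add_sub_cancel]
    refine ⟨k, by simpa using hk, z T,
      fun i => M ^ T *ᵥ (aeval M (prodXSubC a (k - 1 - i)) *ᵥ w), fun i => a (k - 1 - i),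
      fun _ => 1, fun i => zero_le_one.trans (ha _ (by omega)), fun _ => zero_le_one,
      ⟨fun i => (hT i).1, ?_⟩, fun i => ⟨fun r => ?_, ?_⟩⟩
    · rw [← hz T, ← hsum, mulVec_sum, ← Finset.sum_range_reflect, Finset.sum_range]
    · exact (hT r).2 _ (Finset.mem_range.2 (by omega))
    · rw [hMstep]
      congr 1
      split_ifs with hi
      · simp only [one_smul, show k - 1 - ((i : ℕ) - 1) = k - 1 - i + 1 by omega]
      · rw [show k - 1 - (i : ℕ) + 1 = k by omega, hw, mulVec_zero]
  · rintro ⟨k, -, x₁, y, lam, mu, hlam, hmu, ⟨hx₁, hpoint⟩, hray⟩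
    have hy : ∀ i, y i ∈ Submodule.span NNReal (Set.range y) := fun i =>
      Submodule.subset_span ⟨i, rfl⟩
    refine exists_orbit_of_mem_span (fun i => (hray i).1) (fun i => ?_) hx₁ ?_
    · rw [← (hray i).2]
      refine Submodule.add_mem _ (Submodule.smul_mem _ (⟨lam i, hlam i⟩ : NNReal) (hy i)) ?_
      split_ifs
      · exact Submodule.smul_mem _ (⟨mu _, hmu _⟩ : NNReal) (hy _)
      · exact Submodule.zero_mem _
    · rw [← hpoint, add_sub_cancel_left]
      exact Submodule.sum_mem _ fun i _ => hy i
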